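/- arXiv:2312.08426 — 5 statements merged into one kernel-verified Lean document; each statement's English description precedes it below -/
import Mathlib

section
/- Theorem 1 (robust sequences from time-reversal symmetry). Let k n : ℕ, θ φ : Fin k → ℝ, and Θ Φ : ℝ. Define f : ℝ → Matrix (Fin 2) (Fin 2) ℂ by f(ε) := [θ₁(1+ε)]_{φ₁} · ⋯ · [θ_k(1+ε)]_{φ_k} · [θ_k(1+ε)]_{φ_k} · ⋯ · [θ₁(1+ε)]_{φ₁} (the ordered product followed by its reversal). Suppose (fun ε => f(ε) − [Θ]_Φ) =O[𝓝 0] (fun ε => ε^(n+1)). Then for all real α, β, γ, the function g(ε) := Z(α) · [θ₁(1+ε)]_{φ₁} · ⋯ · [θ_k(1+ε)]_{φ_k} · Z(β) · [θ_k(1+ε)]_{φ_k} · ⋯ · [θ₁(1+ε)]_{φ₁} · Z(γ) satisfies (fun ε => g(ε) − Z(α) · [Θ/2]_Φ · Z(β) · [Θ/2]_Φ · Z(γ)) =O[𝓝 0] (fun ε => ε^(n+1)). -/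
open Complex Matrix

noncomputable section

/-- The pulse `[θ]_φ = exp(-i(θ/2)(cos φ σx + sin φ σy))`. -/
def pulse (θ φ : ℝ) : Matrix (Fin 2) (Fin 2) ℂ :=
  !![(Real.cos (θ/2) : ℂ), -Complex.I * Complex.exp (-Complex.I * φ) * Real.sin (θ/2);
     -Complex.I * Complex.exp (Complex.I * φ) * Real.sin (θ/2), (Real.cos (θ/2) : ℂ)]

/-- The Z-rotation `Z(φ)`. -/
def Zrot (φ : ℝ) : Matrix (Fin 2) (Fin 2) ℂ :=
  !![Complex.exp (-Complex.I * φ / 2), 0; 0, Complex.exp (Complex.I * φ / 2)]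

/-- The Pauli matrix `σz`. -/
def σz : Matrix (Fin 2) (Fin 2) ℂ := !![1, 0; 0, -1]

attribute [local instance] Matrix.normedAddCommGroup Matrix.normedSpace

/-- Conjugation by `σz` inverts a pulse. -/
theorem pulse_mul_σz_mul_pulse (θ φ : ℝ) : pulse θ φ * σz * pulse θ φ = σz := by
  have hexp : Complex.exp (-Complex.I * φ) * Complex.exp (Complex.I * φ) = 1 := by
    rw [← Complex.exp_add]; simp
  have hsq : (Real.cos (θ / 2) : ℂ) ^ 2 + (Real.sin (θ / 2) : ℂ) ^ 2 = 1 := by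
    exact_mod_cast Real.cos_sq_add_sin_sq (θ / 2)
  unfold pulse σz
  generalize Complex.exp (-Complex.I * φ) = u at *
  generalize Complex.exp (Complex.I * φ) = v at *
  generalize (Real.cos (θ / 2) : ℂ) = c at *
  generalize (Real.sin (θ / 2) : ℂ) = s at *
  ext i j
  fin_cases i <;> fin_cases j <;> simp [Matrix.mul_apply, Fin.sum_univ_two] <;>
    grind [Complex.I_sq]

theorem pulse_half_mul_self (θ φ : ℝ) : pulse (θ / 2) φ * pulse (θ / 2) φ = pulse θ φ := by
  have hexp : Complex.exp (-Complex.I * φ) * Complex.exp (Complex.I * φ) = 1 := by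
    rw [← Complex.exp_add]; simp
  have hcos : (Real.cos (θ / 2) : ℂ) =
      (Real.cos (θ / 2 / 2) : ℂ) ^ 2 - (Real.sin (θ / 2 / 2) : ℂ) ^ 2 := by
    have := Real.cos_two_mul' (θ / 2 / 2)
    rw [mul_div_cancel₀ _ two_ne_zero] at this
    exact_mod_cast this
  have hsin : (Real.sin (θ / 2) : ℂ) =
      2 * (Real.sin (θ / 2 / 2) : ℂ) * (Real.cos (θ / 2 / 2) : ℂ) := by
    have := Real.sin_two_mul (θ / 2 / 2)
    rw [mul_div_cancel₀ _ two_ne_zero] at this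
    exact_mod_cast this
  unfold pulse
  rw [hcos, hsin]
  generalize Complex.exp (-Complex.I * φ) = u at *
  generalize Complex.exp (Complex.I * φ) = v at *
  generalize (Real.cos (θ / 2 / 2) : ℂ) = c at *
  generalize (Real.sin (θ / 2 / 2) : ℂ) = s at *
  ext i j
  fin_cases i <;> fin_cases j <;> simp [Matrix.mul_apply, Fin.sum_univ_two] <;>
    grind [Complex.I_sq]

theorem Zrot_eq (β : ℝ) :
    Zrot β = Complex.cos (β / 2) • (1 : Matrix (Fin 2) (Fin 2) ℂ)
      - (Complex.I * Complex.sin (β / 2)) • σz := by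
  have hpos : Complex.exp (Complex.I * β / 2) =
      Complex.cos (β / 2) + Complex.I * Complex.sin (β / 2) := by
    rw [mul_div_assoc, mul_comm, Complex.exp_mul_I, mul_comm Complex.I]
  have hneg : Complex.exp (-Complex.I * β / 2) =
      Complex.cos (β / 2) - Complex.I * Complex.sin (β / 2) := by
    rw [show -Complex.I * β / 2 = (-(β / 2 : ℂ)) * Complex.I by ring, Complex.exp_mul_I,
      Complex.cos_neg, Complex.sin_neg]
    ring
  unfold Zrot σz
  rw [hpos, hneg]
  ext i j
  fin_cases i <;> fin_cases j <;> simp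

/-- If every factor fixes `s` under `A ↦ A * s * A`, so does a product paired with its reversal. -/
theorem List.prod_mul_mul_reverse_prod {M : Type*} [Monoid M] {s : M} {l : List M}
    (hl : ∀ A ∈ l, A * s * A = s) : l.prod * s * l.reverse.prod = s := by
  induction l with
  | nil => simp
  | cons A l ih =>
    have ih' := ih fun B hB => hl B (List.mem_cons_of_mem A hB)
    calc (A :: l).prod * s * (A :: l).reverse.prod
        = A * (l.prod * s * l.reverse.prod) * A := by simp [mul_assoc]
      _ = s := by rw [ih', hl A List.mem_cons_self]

theorem mul_Zrot_mul_of_mul_σz_mul {P R : Matrix (Fin 2) (Fin 2) ℂ} (h : P * σz * R = σz)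
    (β : ℝ) :
    P * Zrot β * R =
      Complex.cos (β / 2) • (P * R) - (Complex.I * Complex.sin (β / 2)) • σz := by
  rw [Zrot_eq]
  simp only [mul_sub, sub_mul, Matrix.mul_smul, Matrix.smul_mul, mul_one, h]

/-- Theorem 1: a time-reversal symmetric composite sequence robust to amplitude error
to order `n+1` yields a whole class of robust sequences with inserted Z-rotations. -/
theorem robust_sequences_from_time_reversal_symmetry
    (k n : ℕ) (θ φ : Fin k → ℝ) (Θ Φ : ℝ)
    (h : (fun ε : ℝ =>
        (List.ofFn fun i => pulse (θ i * (1 + ε)) (φ i)).prod *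
          (List.ofFn fun i => pulse (θ i * (1 + ε)) (φ i)).reverse.prod
          - pulse Θ Φ) =O[nhds (0 : ℝ)] fun ε => ε ^ (n + 1)) :
    ∀ α β γ : ℝ,
      (fun ε : ℝ =>
        Zrot α * (List.ofFn fun i => pulse (θ i * (1 + ε)) (φ i)).prod * Zrot β *
            (List.ofFn fun i => pulse (θ i * (1 + ε)) (φ i)).reverse.prod * Zrot γ
          - Zrot α * pulse (Θ / 2) Φ * Zrot β * pulse (Θ / 2) Φ * Zrot γ)
        =O[nhds (0 : ℝ)] fun ε => ε ^ (n + 1) := by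
  intro α β γ
  let L : Matrix (Fin 2) (Fin 2) ℂ →ₗ[ℂ] Matrix (Fin 2) (Fin 2) ℂ :=
    Complex.cos (β / 2) • (LinearMap.mulLeft ℂ (Zrot α) ∘ₗ LinearMap.mulRight ℂ (Zrot γ))
  refine ((L.toContinuousLinearMap.isBigO_comp _ _).trans h).congr_left fun ε => ?_
  have hP := List.prod_mul_mul_reverse_prod (s := σz)
    (l := List.ofFn fun i => pulse (θ i * (1 + ε)) (φ i)) (by
      simp only [List.mem_ofFn]
      rintro _ ⟨i, rfl⟩
      exact pulse_mul_σz_mul_pulse _ _)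
  have hP' := mul_Zrot_mul_of_mul_σz_mul hP β
  have hQ' := mul_Zrot_mul_of_mul_σz_mul (pulse_mul_σz_mul_pulse (Θ / 2) Φ) β
  rw [pulse_half_mul_self] at hQ'
  generalize (List.ofFn fun i => pulse (θ i * (1 + ε)) (φ i)).prod = P at *
  generalize (List.ofFn fun i => pulse (θ i * (1 + ε)) (φ i)).reverse.prod = R at *
  calc L (P * R - pulse Θ Φ)
      = Zrot α * (P * Zrot β * R - pulse (Θ / 2) Φ * Zrot β * pulse (Θ / 2) Φ) * Zrot γ := by
        rw [hP', hQ', sub_sub_sub_cancel_right, ← smul_sub, Matrix.mul_smul, Matrix.smul_mul,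
          mul_assoc]
        rfl
    _ = _ := by simp only [mul_sub, sub_mul, mul_assoc]
end
end

section
/- Half-pulse Z-sandwich identity: for all real θ, φ, β, one has [θ/2]_φ · Z(β) · [θ/2]_φ = cos(β/2) · [θ]_φ − i · sin(β/2) · σz. -/
open Complex Matrix

noncomputable section

attribute [local instance] Matrix.normedAddCommGroup Matrix.normedSpace

/-- Half-pulse Z-sandwich identity:
`[θ/2]_φ · Z(β) · [θ/2]_φ = cos(β/2) [θ]_φ − i sin(β/2) σz`. -/
theorem half_pulse_Z_sandwich (θ φ β : ℝ) :
    pulse (θ / 2) φ * Zrot β * pulse (θ / 2) φ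
      = (Real.cos (β / 2) : ℂ) • pulse θ φ - (Complex.I * Real.sin (β / 2)) • σz := by
  have hcos : (Real.cos (θ / 2) : ℂ)
      = (Real.cos (θ / 2 / 2) : ℂ) ^ 2 - (Real.sin (θ / 2 / 2) : ℂ) ^ 2 := by
    rw [← mul_div_cancel₀ (θ / 2) (two_ne_zero' ℝ), mul_div_assoc, Real.cos_two_mul']
    push_cast
    ring_nf
  have hsin : (Real.sin (θ / 2) : ℂ)
      = 2 * (Real.sin (θ / 2 / 2) : ℂ) * (Real.cos (θ / 2 / 2) : ℂ) := by
    rw [← mul_div_cancel₀ (θ / 2) (two_ne_zero' ℝ), mul_div_assoc, Real.sin_two_mul]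
    push_cast
    ring_nf
  have hsq : (Real.sin (θ / 2 / 2) : ℂ) ^ 2 + (Real.cos (θ / 2 / 2) : ℂ) ^ 2 = 1 := by
    exact_mod_cast Real.sin_sq_add_cos_sq (θ / 2 / 2)
  have hpos : Complex.exp (Complex.I * β / 2)
      = (Real.cos (β / 2) : ℂ) + Complex.I * (Real.sin (β / 2) : ℂ) := by
    rw [show Complex.I * (β : ℂ) / 2 = ((β / 2 : ℝ) : ℂ) * Complex.I by push_cast; ring,
      Complex.exp_mul_I, ← Complex.ofReal_cos, ← Complex.ofReal_sin]
    ring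
  have hneg : Complex.exp (-Complex.I * β / 2)
      = (Real.cos (β / 2) : ℂ) - Complex.I * (Real.sin (β / 2) : ℂ) := by
    rw [show -Complex.I * (β : ℂ) / 2 = ((-(β / 2) : ℝ) : ℂ) * Complex.I by push_cast; ring,
      Complex.exp_mul_I, ← Complex.ofReal_cos, ← Complex.ofReal_sin, Real.cos_neg, Real.sin_neg]
    push_cast
    ring
  have hexp : Complex.exp (-Complex.I * φ) * Complex.exp (Complex.I * φ) = 1 := by
    rw [← Complex.exp_add]
    simp
  unfold pulse Zrot σz
  rw [hcos, hsin, hpos, hneg]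
  generalize (Real.cos (θ / 2 / 2) : ℂ) = c at *
  generalize (Real.sin (θ / 2 / 2) : ℂ) = s at *
  generalize (Real.cos (β / 2) : ℂ) = C at *
  generalize (Real.sin (β / 2) : ℂ) = S at *
  generalize Complex.exp (-Complex.I * φ) = p at *
  generalize Complex.exp (Complex.I * φ) = q at *
  have hI := Complex.I_sq
  ext i j
  fin_cases i <;> fin_cases j <;>
    simp [Matrix.mul_apply, Fin.sum_univ_two] <;> clear hcos hsin hpos hneg <;> grind
end
end

section
/- First-order amplitude robustness of the composite pulse RA1: let θ : ℝ with |θ| ≤ 2π and set ϑ := Real.arccos(−θ/(2π)). Define g : ℝ → Matrix (Fin 2) (Fin 2) ℂ by g(ε) := [ϑ(1+ε)]_{π/2} · [π(1+ε)]_0 · [2ϑ(1+ε)]_{π/2} · [π(1+ε)]_0 · [ϑ(1+ε)]_{π/2} · [θ(1+ε)]_0. Then g(0) = −[θ]_0 and (fun ε => g(ε) + [θ]_0) =O[𝓝 0] (fun ε => ε^2). -/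
open Complex Matrix

noncomputable section

attribute [local instance] Matrix.normedAddCommGroup Matrix.normedSpace

/-- A real-analytic function vanishing to first order at the origin is quadratically small there. -/
theorem isBigO_sq_of_analyticAt_of_hasDerivAt_zero {f : ℝ → ℝ} (hf : AnalyticAt ℝ f 0)
    (h0 : f 0 = 0) (h1 : HasDerivAt f 0 0) : f =O[nhds (0 : ℝ)] fun ε => ε ^ 2 := by
  obtain ⟨p, hp⟩ := hf
  have h := hp.isBigO_sub_partialSum_pow 2
  have hd : p 1 (fun _ => 1) = 0 := hp.deriv.symm.trans h1.deriv
  have hs : ∀ y : ℝ, p.partialSum 2 y = 0 := by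
    intro y
    have hc : p.coeff 0 = 0 := (hp.coeff_zero _).trans h0
    have hd' : p.coeff 1 = 0 := hd
    simp [FormalMultilinearSeries.partialSum, Finset.sum_range_succ, hc, hd']
  simpa [hs] using h

theorem pulse_zero (θ : ℝ) :
    pulse θ 0 = !![(Real.cos (θ / 2) : ℂ), -I * Real.sin (θ / 2);
      -I * Real.sin (θ / 2), (Real.cos (θ / 2) : ℂ)] := by
  simp [pulse]

theorem pulse_pi_div_two (θ : ℝ) :
    pulse θ (Real.pi / 2) = !![(Real.cos (θ / 2) : ℂ), -(Real.sin (θ / 2) : ℂ);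
      (Real.sin (θ / 2) : ℂ), (Real.cos (θ / 2) : ℂ)] := by
  have h : exp (I * (Real.pi / 2 : ℝ)) = I := by
    rw [mul_comm, exp_mul_I, ← ofReal_cos, ← ofReal_sin]; simp
  have h' : exp (-I * (Real.pi / 2 : ℝ)) = -I := by
    rw [neg_mul, exp_neg, h, inv_I]
  rw [pulse, h, h']
  simp

/-- The composite of the five correcting pulses, with pulse angles `t` and amplitude error `ε`. -/
theorem pulse_mul_pulse_pi_sandwich (t ε : ℝ) :
    pulse t (Real.pi / 2) * pulse (Real.pi * (1 + ε)) 0 * pulse (2 * t) (Real.pi / 2) *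
        pulse (Real.pi * (1 + ε)) 0 * pulse t (Real.pi / 2) =
      let c := Real.cos (Real.pi * ε / 2)
      let s := Real.sin (Real.pi * ε / 2)
      let p : ℂ := ↑(c ^ 2 - s ^ 2 * Real.cos (2 * t))
      let q : ℂ := ↑(2 * s * c * Real.cos t)
      let r : ℂ := ↑(s ^ 2 * Real.sin (2 * t))
      !![-p, I * q - r; I * q + r, -p] := by
  have hc : Real.cos (Real.pi * (1 + ε) / 2) = -Real.sin (Real.pi * ε / 2) := by
    rw [← Real.cos_add_pi_div_two]; ring_nf
  have hs : Real.sin (Real.pi * (1 + ε) / 2) = Real.cos (Real.pi * ε / 2) := by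
    rw [← Real.sin_add_pi_div_two]; ring_nf
  obtain ⟨x, rfl⟩ : ∃ x, t = 2 * x := ⟨t / 2, by ring⟩
  rw [pulse_zero, pulse_pi_div_two, pulse_pi_div_two, hc, hs,
    show 2 * x / 2 = x by ring, show 2 * (2 * x) / 2 = 2 * x by ring]
  have hx := congrArg (fun y : ℝ => (y : ℂ)) (Real.sin_sq_add_cos_sq x)
  simp only [Real.cos_two_mul, Real.sin_two_mul]
  push_cast at hx ⊢
  generalize cos (x : ℂ) = a at *
  generalize sin (x : ℂ) = b at *
  generalize cos ((Real.pi : ℂ) * ε / 2) = c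
  generalize sin ((Real.pi : ℂ) * ε / 2) = s
  have hI := I_sq
  ext i j
  fin_cases i <;> fin_cases j <;> simp [Matrix.mul_apply, Fin.sum_univ_two] <;> grind

/-- First-order amplitude robustness of the composite pulse RA1. -/
theorem RA1_first_order_robust (θ : ℝ) (hθ : |θ| ≤ 2 * Real.pi)
    (ϑ : ℝ) (hϑ : ϑ = Real.arccos (-θ / (2 * Real.pi)))
    (g : ℝ → Matrix (Fin 2) (Fin 2) ℂ)
    (hg : ∀ ε : ℝ, g ε =
      pulse (ϑ * (1 + ε)) (Real.pi / 2) * pulse (Real.pi * (1 + ε)) 0 *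
        pulse (2 * ϑ * (1 + ε)) (Real.pi / 2) * pulse (Real.pi * (1 + ε)) 0 *
        pulse (ϑ * (1 + ε)) (Real.pi / 2) * pulse (θ * (1 + ε)) 0) :
    g 0 = -pulse θ 0 ∧
      (fun ε : ℝ => g ε + pulse θ 0) =O[nhds (0 : ℝ)] fun ε => ε ^ 2 := by
  have key : ∀ ε : ℝ, g ε =
      let c := Real.cos (Real.pi * ε / 2)
      let s := Real.sin (Real.pi * ε / 2)
      let t := ϑ * (1 + ε)
      let α := θ * (1 + ε) / 2
      let p := c ^ 2 - s ^ 2 * Real.cos (2 * t)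
      let q := 2 * s * c * Real.cos t
      let r := s ^ 2 * Real.sin (2 * t)
      !![-(p * Real.cos α - q * Real.sin α : ℝ) + I * (r * Real.sin α : ℝ),
          I * (p * Real.sin α + q * Real.cos α : ℝ) - (r * Real.cos α : ℝ);
        I * (p * Real.sin α + q * Real.cos α : ℝ) + (r * Real.cos α : ℝ),
          -(p * Real.cos α - q * Real.sin α : ℝ) - I * (r * Real.sin α : ℝ)] := by
    intro ε
    rw [hg, mul_assoc 2 ϑ, pulse_mul_pulse_pi_sandwich, pulse_zero]
    have hI := I_sq
    ext i j
    fin_cases i <;> fin_cases j <;> simp [Matrix.mul_apply, Fin.sum_univ_two] <;> grind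
  have hcos : 2 * Real.pi * Real.cos ϑ = -θ := by
    have hpi := Real.pi_pos
    have := abs_le.mp hθ
    rw [hϑ, Real.cos_arccos]
    · field_simp
    · rw [le_div_iff₀ (by positivity)]; linarith
    · rw [div_le_iff₀ (by positivity)]; linarith
  refine ⟨?_, ?_⟩
  · rw [key, pulse_zero]
    ext i j
    fin_cases i <;> fin_cases j <;> simp
  have hasDeriv_lin (k : ℝ) : HasDerivAt (fun ε : ℝ => k * (1 + ε)) k 0 := by
    simpa using ((hasDerivAt_id (0 : ℝ)).const_add 1).const_mul k
  have hα : HasDerivAt (fun ε : ℝ => θ * (1 + ε) / 2) (θ / 2) 0 := (hasDeriv_lin θ).div_const 2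
  have ht := hasDeriv_lin ϑ
  have hu : HasDerivAt (fun ε : ℝ => Real.pi * ε / 2) (Real.pi / 2) 0 := by
    simpa using ((hasDerivAt_id (0 : ℝ)).const_mul Real.pi).div_const 2
  have hp := (hu.cos.fun_pow 2).fun_sub ((hu.sin.fun_pow 2).fun_mul (ht.const_mul 2).cos)
  have hq := ((hu.sin.const_mul 2).fun_mul hu.cos).fun_mul ht.cos
  have hr := (hu.sin.fun_pow 2).fun_mul (ht.const_mul 2).sin
  have hre := isBigO_sq_of_analyticAt_of_hasDerivAt_zero
    (f := fun ε => (Real.cos (Real.pi * ε / 2) ^ 2 -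
        Real.sin (Real.pi * ε / 2) ^ 2 * Real.cos (2 * (ϑ * (1 + ε)))) *
        Real.cos (θ * (1 + ε) / 2) -
      2 * Real.sin (Real.pi * ε / 2) * Real.cos (Real.pi * ε / 2) * Real.cos (ϑ * (1 + ε)) *
        Real.sin (θ * (1 + ε) / 2) - Real.cos (θ / 2))
    (by fun_prop) (by simp)
    (by
      refine ((((hp.fun_mul hα.cos).fun_sub (hq.fun_mul hα.sin)).sub_const
        (Real.cos (θ / 2)))).congr_deriv ?_
      simp
      linear_combination -(Real.sin (θ / 2) / 2) * hcos)
  have him := isBigO_sq_of_analyticAt_of_hasDerivAt_zero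
    (f := fun ε => (Real.cos (Real.pi * ε / 2) ^ 2 -
        Real.sin (Real.pi * ε / 2) ^ 2 * Real.cos (2 * (ϑ * (1 + ε)))) *
        Real.sin (θ * (1 + ε) / 2) +
      2 * Real.sin (Real.pi * ε / 2) * Real.cos (Real.pi * ε / 2) * Real.cos (ϑ * (1 + ε)) *
        Real.cos (θ * (1 + ε) / 2) - Real.sin (θ / 2))
    (by fun_prop) (by simp)
    (by
      refine ((((hp.fun_mul hα.sin).fun_add (hq.fun_mul hα.cos)).sub_const
        (Real.sin (θ / 2)))).congr_deriv ?_
      simp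
      linear_combination (Real.cos (θ / 2) / 2) * hcos)
  have hrs := isBigO_sq_of_analyticAt_of_hasDerivAt_zero
    (f := fun ε => Real.sin (Real.pi * ε / 2) ^ 2 * Real.sin (2 * (ϑ * (1 + ε))) *
      Real.sin (θ * (1 + ε) / 2))
    (by fun_prop) (by simp)
    ((hr.fun_mul hα.sin).congr_deriv (by simp))
  have hrc := isBigO_sq_of_analyticAt_of_hasDerivAt_zero
    (f := fun ε => Real.sin (Real.pi * ε / 2) ^ 2 * Real.sin (2 * (ϑ * (1 + ε))) *
      Real.cos (θ * (1 + ε) / 2))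
    (by fun_prop) (by simp)
    ((hr.fun_mul hα.cos).congr_deriv (by simp))
  have lift {f : ℝ → ℝ} (hf : f =O[nhds (0 : ℝ)] fun ε => ε ^ 2) :
      (fun ε => (f ε : ℂ)) =O[nhds (0 : ℝ)] fun ε => ε ^ 2 :=
    (Asymptotics.isBigO_of_le _ fun ε => by simp).trans hf
  refine Asymptotics.isBigO_pi.2 fun i => Asymptotics.isBigO_pi.2 fun j => ?_
  simp only [key, pulse_zero]
  fin_cases i <;> fin_cases j
  · refine ((lift hre).neg_left.add ((lift hrs).const_mul_left I)).congr_left fun ε => ?_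
    simp; ring
  · refine (((lift him).const_mul_left I).sub (lift hrc)).congr_left fun ε => ?_
    simp; ring
  · refine (((lift him).const_mul_left I).add (lift hrc)).congr_left fun ε => ?_
    simp; ring
  · refine ((lift hre).neg_left.sub ((lift hrs).const_mul_left I)).congr_left fun ε => ?_
    simp; ring
end
end

section
/- Phase-control decomposition of an arbitrary SU(2) unitary: for all real α, β, γ, one has [π/2]_α · [π]_{(γ+α−β)/2} · [π/2]_γ = Z(α) · [β]_{π/2} · Z(2π − γ). -/
open Complex Matrix

noncomputable section

attribute [local instance] Matrix.normedAddCommGroup Matrix.normedSpace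

/-- Phase-control decomposition of an arbitrary SU(2) unitary:
`[π/2]_α [π]_{(γ+α−β)/2} [π/2]_γ = Z(α) Y(β) Z(2π − γ)`. -/
theorem phase_control_decomposition (α β γ : ℝ) :
    pulse (Real.pi / 2) α * pulse Real.pi ((γ + α - β) / 2) * pulse (Real.pi / 2) γ
      = Zrot α * pulse β (Real.pi / 2) * Zrot (2 * Real.pi - γ) := by
  have hs : ((Real.sqrt 2 : ℝ) : ℂ) ^ 2 = 2 := by
    norm_cast
    exact Real.sq_sqrt zero_le_two
  have exp_two_half (x : ℝ) : exp (I * x) = exp (I * x / 2) ^ 2 := by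
    rw [← Complex.exp_nat_mul]
    congr 1
    push_cast
    ring
  have exp_phase :
      exp (I * ((γ + α - β) / 2 : ℝ)) =
        exp (I * γ / 2) * exp (I * α / 2) / exp (I * β / 2) := by
    rw [← Complex.exp_add, ← Complex.exp_sub]
    congr 1
    push_cast
    ring
  have exp_complement :
      exp (I * (2 * Real.pi - γ : ℝ) / 2) = -(exp (I * γ / 2))⁻¹ := by
    rw [show I * ((2 * Real.pi - γ : ℝ) : ℂ) / 2 = Real.pi * I - I * γ / 2 by push_cast; ring,
      Complex.exp_sub, Complex.exp_pi_mul_I, neg_div, one_div]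
  have exp_quarter : exp (I * (Real.pi / 2 : ℝ)) = I := by
    rw [mul_comm]
    push_cast
    exact Complex.exp_pi_div_two_mul_I
  have cos_half : ((Real.cos (β / 2) : ℝ) : ℂ) =
      (exp (I * β / 2) + (exp (I * β / 2))⁻¹) / 2 := by
    rw [Complex.ofReal_cos, Complex.cos, ← Complex.exp_neg]
    push_cast
    ring_nf
  have sin_half : ((Real.sin (β / 2) : ℝ) : ℂ) =
      ((exp (I * β / 2))⁻¹ - exp (I * β / 2)) * I / 2 := by
    rw [Complex.ofReal_sin, Complex.sin, ← Complex.exp_neg]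
    push_cast
    ring_nf
  have quarter : Real.pi / 2 / 2 = Real.pi / 4 := by ring
  simp only [pulse, Zrot, neg_mul, neg_div, Complex.exp_neg, quarter, Real.cos_pi_div_four,
    Real.sin_pi_div_four, Real.cos_pi_div_two, Real.sin_pi_div_two, exp_phase, exp_complement,
    exp_quarter, cos_half, sin_half, exp_two_half α, exp_two_half γ]
  have ha := Complex.exp_ne_zero (I * α / 2)
  have hb := Complex.exp_ne_zero (I * β / 2)
  have hg := Complex.exp_ne_zero (I * γ / 2)
  generalize exp (I * α / 2) = a at *
  generalize exp (I * β / 2) = b at *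
  generalize exp (I * γ / 2) = g at *
  push_cast
  generalize ((Real.sqrt 2 : ℝ) : ℂ) = r at *
  have hI := Complex.I_sq
  ext i j
  fin_cases i <;> fin_cases j <;> simp [Matrix.mul_apply, Fin.sum_univ_two] <;> field_simp <;>
    grind
end
end

section
/- Closed-form solution of the UP1 robustness equations: let a s : ℝ satisfy a² + s² ≤ 16 and D := a² + s·(s − 4) ≠ 0. Set R := Real.sqrt((a² + s²)·(16 − a² − s²)), t₁ := −(4a + R)/D and t₂ := (−4a + R)/D. Then sin(2·arctan t₁) + sin(2·arctan t₂) = −a/2 and cos(2·arctan t₁) + cos(2·arctan t₂) = −s/2. -/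
open Real

lemma sin_two_mul_arctan_eq (t : ℝ) : Real.sin (2 * Real.arctan t) = 2 * t / (1 + t ^ 2) := by
  have h : Real.sin (arctan t) = t * Real.cos (arctan t) := by
    rw [Real.sin_arctan, Real.cos_arctan]
    ring
  rw [Real.sin_two_mul, h]
  linear_combination 2 * t * Real.cos_sq_arctan t

lemma cos_two_mul_arctan_eq (t : ℝ) :
    Real.cos (2 * Real.arctan t) = (1 - t ^ 2) / (1 + t ^ 2) := by
  have h : 1 + t ^ 2 ≠ 0 := by positivity
  rw [Real.cos_two_mul, Real.cos_sq_arctan]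
  field_simp
  ring

/-- Closed-form Weierstrass-substitution solution of the first-order robustness
system for the composite pulse UP1. -/
theorem UP1_closed_form_solution
    (a s : ℝ) (hbound : a ^ 2 + s ^ 2 ≤ 16)
    (D : ℝ) (hD : D = a ^ 2 + s * (s - 4)) (hD0 : D ≠ 0)
    (R : ℝ) (hR : R = Real.sqrt ((a ^ 2 + s ^ 2) * (16 - a ^ 2 - s ^ 2)))
    (t₁ t₂ : ℝ) (ht₁ : t₁ = -(4 * a + R) / D) (ht₂ : t₂ = (-(4 * a) + R) / D) :
    Real.sin (2 * Real.arctan t₁) + Real.sin (2 * Real.arctan t₂) = -a / 2 ∧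
    Real.cos (2 * Real.arctan t₁) + Real.cos (2 * Real.arctan t₂) = -s / 2 := by
  have hR2 : R ^ 2 = (a ^ 2 + s ^ 2) * (16 - a ^ 2 - s ^ 2) := by
    rw [hR]
    exact Real.sq_sqrt (mul_nonneg (by positivity) (by linarith))
  have h₁ : D * t₁ = -(4 * a + R) := by rw [ht₁]; field_simp
  have h₂ : D * t₂ = -(4 * a) + R := by rw [ht₂]; field_simp
  have hsum : D * (t₁ + t₂) = -8 * a := by linear_combination h₁ + h₂
  have hprod : D * (t₁ * t₂) = a ^ 2 + s ^ 2 + 4 * s := by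
    apply mul_left_cancel₀ hD0
    calc D * (D * (t₁ * t₂)) = (D * t₁) * (D * t₂) := by ring
      _ = D * (a ^ 2 + s ^ 2 + 4 * s) := by
        rw [h₁, h₂, hD]
        linear_combination -hR2
  have hadd : D * (1 + t₁ * t₂) = 2 * (a ^ 2 + s ^ 2) := by
    linear_combination hprod + hD
  have hsub : D * (1 - t₁ * t₂) = -8 * s := by
    linear_combination hD - hprod
  have hden : D ^ 2 * ((1 + t₁ ^ 2) * (1 + t₂ ^ 2)) = 64 * (a ^ 2 + s ^ 2) := by
    calc D ^ 2 * ((1 + t₁ ^ 2) * (1 + t₂ ^ 2))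
        = (D * (1 - t₁ * t₂)) ^ 2 + (D * (t₁ + t₂)) ^ 2 := by ring
      _ = 64 * (a ^ 2 + s ^ 2) := by rw [hsub, hsum]; ring
  have hD2 : D ^ 2 ≠ 0 := pow_ne_zero 2 hD0
  have hp₁ : 1 + t₁ ^ 2 ≠ 0 := by positivity
  have hp₂ : 1 + t₂ ^ 2 ≠ 0 := by positivity
  rw [sin_two_mul_arctan_eq, sin_two_mul_arctan_eq, cos_two_mul_arctan_eq,
    cos_two_mul_arctan_eq, div_add_div _ _ hp₁ hp₂, div_add_div _ _ hp₁ hp₂,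
    div_eq_iff (mul_ne_zero hp₁ hp₂), div_eq_iff (mul_ne_zero hp₁ hp₂)]
  constructor
  · apply mul_left_cancel₀ hD2
    calc _ = 2 * (D * (t₁ + t₂)) * (D * (1 + t₁ * t₂)) := by ring
      _ = _ := by
        rw [hsum, hadd]
        linear_combination (a / 2) * hden
  · apply mul_left_cancel₀ hD2
    calc _ = 2 * (D * (1 - t₁ * t₂)) * (D * (1 + t₁ * t₂)) := by ring
      _ = _ := by
        rw [hsub, hadd]
        linear_combination (s / 2) * hden
end
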